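/- arXiv:2110.05992 — 2 statements merged into one kernel-verified Lean document; each statement's English description precedes it below -/
import Mathlib

section
/- Let T be a finite type, n a natural number, and N : T → T → ℕ a symmetric function (N i j = N j i for all i, j). Then the sum over all functions f : Fin n → T of the product, over all unordered pairs {c,d} of distinct elements of Fin n, of N(f c)(f d), equals the sum over all functions k : T → ℕ with ∑_{i∈T} k(i) = n of the multinomial coefficient n! / ∏_{i∈T} k(i)! times ∏_{i∈T} N(i,i)^{k(i)(k(i)−1)/2} times ∏_{unordered pairs i≠j in T} N(i,j)^{k(i)·k(j)}. -/
open Finset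

/-- The number of functions `Fin n → T` with prescribed fiber cardinalities is a multinomial
coefficient. -/
theorem card_filter_card_fiber_eq_multinomial {T : Type*} [Fintype T] [DecidableEq T]
    (n : ℕ) (k : T → ℕ) (hk : ∑ i, k i = n) :
    #{f : Fin n → T | (fun i => #{c | f c = i}) = k} = Nat.multinomial univ k := by
  have hprod (f : Fin n → T) : ∏ c, (MvPolynomial.X (f c) : MvPolynomial T ℕ) =
      MvPolynomial.monomial (∑ c, Finsupp.single (f c) 1) 1 := by
    rw [MvPolynomial.monomial_sum_one]
    rfl
  have hcoeff := MvPolynomial.coeff_sum_X_pow_of_fintype (R := ℕ) (Finsupp.equivFunOnFinite.symm k) n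
  have hdeg : ((Finsupp.equivFunOnFinite.symm k).sum fun _ m => m) = n := by
    rw [Finsupp.sum_fintype _ _ fun _ => rfl]
    simpa using hk
  rw [if_pos hdeg, Finsupp.multinomial_eq_of_support_subset (subset_univ _), sum_pow',
    Fintype.piFinset_univ] at hcoeff
  simp only [hprod, MvPolynomial.coeff_sum, MvPolynomial.coeff_monomial] at hcoeff
  rw [card_filter]
  refine Eq.trans (sum_congr rfl fun f _ => if_congr ?_ rfl rfl) hcoeff
  rw [Finsupp.ext_iff, funext_iff]
  refine forall_congr' fun i => ?_
  simp [Finsupp.finsetSum_apply, Finsupp.single_apply]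

theorem prod_lt_fin_succ {M : Type*} [CommMonoid M] (n : ℕ) (g : Fin (n + 1) → Fin (n + 1) → M) :
    ∏ p : Fin (n + 1) × Fin (n + 1) with p.1 < p.2, g p.1 p.2 =
      (∏ d : Fin n, g 0 d.succ) * ∏ p : Fin n × Fin n with p.1 < p.2, g p.1.succ p.2.succ := by
  simp [prod_filter, Fintype.prod_prod_type, Fin.prod_univ_succ]

/-- Increasing one coordinate of the exponent vector multiplies the off-diagonal and diagonal
weights by a single row of `N`. -/
theorem prod_pow_choose_two_mul_prod_lt_add_single {T M : Type*} [Fintype T] [LinearOrder T]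
    [CommMonoid M] (N : T → T → M) (hN : ∀ i j, N i j = N j i) (k : T → ℕ) (a : T) :
    (∏ i, N i i ^ (k i + if a = i then 1 else 0).choose 2) *
        ∏ p : T × T with p.1 < p.2,
          N p.1 p.2 ^ ((k p.1 + if a = p.1 then 1 else 0) * (k p.2 + if a = p.2 then 1 else 0)) =
      (∏ j, N a j ^ k j) *
        ((∏ i, N i i ^ (k i).choose 2) *
          ∏ p : T × T with p.1 < p.2, N p.1 p.2 ^ (k p.1 * k p.2)) := by
  have hdiag : ∏ i, N i i ^ (k i + if a = i then 1 else 0).choose 2 =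
      N a a ^ k a * ∏ i, N i i ^ (k i).choose 2 := by
    have (i : T) : N i i ^ (k i + if a = i then 1 else 0).choose 2 =
        (if a = i then N i i ^ k i else 1) * N i i ^ (k i).choose 2 := by
      split_ifs
      · rw [Nat.choose_succ_succ' (k i) 1, Nat.choose_one_right, pow_add]
      · simp
    simp only [this, prod_mul_distrib, prod_ite_eq, mem_univ, if_true]
  have hoff : ∏ p : T × T with p.1 < p.2,
        N p.1 p.2 ^ ((k p.1 + if a = p.1 then 1 else 0) * (k p.2 + if a = p.2 then 1 else 0)) =
      ((∏ j, if a < j then N a j ^ k j else 1) * ∏ j, if j < a then N a j ^ k j else 1) *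
        ∏ p : T × T with p.1 < p.2, N p.1 p.2 ^ (k p.1 * k p.2) := by
    have (i j : T) : (if i < j then
          N i j ^ ((k i + if a = i then 1 else 0) * (k j + if a = j then 1 else 0)) else 1) =
        ((if a = i then (if i < j then N i j ^ k j else 1) else 1) *
          (if a = j then (if i < j then N j i ^ k i else 1) else 1)) *
          (if i < j then N i j ^ (k i * k j) else 1) := by
      rw [hN j i]
      by_cases hij : i < j
      · by_cases hi : a = i
        · have hj : a ≠ j := hi ▸ hij.ne
          simp [hij, hi, hij.ne, Nat.add_one_mul, pow_add, mul_comm (N i j ^ k j)]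
        · by_cases hj : a = j
          · simp [hij, hj, hij.ne', Nat.mul_add_one, pow_add, mul_comm (N i j ^ k i)]
          · simp [hi, hj]
      · simp [hij]
    simp only [prod_filter, Fintype.prod_prod_type, this, prod_mul_distrib]
    congr 2
    · rw [prod_comm]
      simp
    · simp
  have hrow : ∏ j, N a j ^ k j = N a a ^ k a *
      ((∏ j, if a < j then N a j ^ k j else 1) * ∏ j, if j < a then N a j ^ k j else 1) := by
    have (j : T) : N a j ^ k j = (if a = j then N a j ^ k j else 1) *
        ((if a < j then N a j ^ k j else 1) * if j < a then N a j ^ k j else 1) := by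
      rcases lt_trichotomy a j with h | h | h
      · simp [h, h.ne, h.not_gt]
      · simp [h]
      · simp [h, h.ne', h.not_gt]
    rw [prod_congr rfl fun j _ => this j]
    simp only [prod_mul_distrib, prod_ite_eq, mem_univ, if_true]
  rw [hdiag, hoff, hrow]
  exact mul_mul_mul_comm _ _ _ _

/-- The product of the pairwise weights of an assignment only depends on its fiber
cardinalities. -/
theorem prod_lt_apply_eq_prod_pow_card_fiber {T M : Type*} [Fintype T] [LinearOrder T]
    [CommMonoid M] (N : T → T → M) (hN : ∀ i j, N i j = N j i) (n : ℕ) (f : Fin n → T) :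
    ∏ p : Fin n × Fin n with p.1 < p.2, N (f p.1) (f p.2) =
      (∏ i, N i i ^ (#{c | f c = i}).choose 2) *
        ∏ p : T × T with p.1 < p.2, N p.1 p.2 ^ (#{c | f c = p.1} * #{c | f c = p.2}) := by
  induction n with
  | zero => simp
  | succ n ih =>
    have hcard (i : T) : #{c | f c = i} =
        #{c : Fin n | f c.succ = i} + if f 0 = i then 1 else 0 := by
      simp only [card_filter, Fin.sum_univ_succ, add_comm]
    have hrow : ∏ d : Fin n, N (f 0) (f d.succ) =
        ∏ j, N (f 0) j ^ #{c : Fin n | f c.succ = j} := by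
      rw [← prod_fiberwise' univ (fun d : Fin n => f d.succ) (N (f 0))]
      simp
    simp only [hcard]
    rw [prod_lt_fin_succ n fun c d => N (f c) (f d), ih fun c => f c.succ, hrow,
      prod_pow_choose_two_mul_prod_lt_add_single N hN]

/-- The combinatorial core of Theorem 1 (Beame et al.): for a symmetric weight
function `N` on a finite (linearly ordered) type `T` of 1-types, the sum over all
assignments `f : Fin n → T` of the product of the pairwise weights `N (f c) (f d)`
over all unordered pairs of distinct elements `{c, d}` of `Fin n` equals the sum,
over all vectors `k : T → ℕ` with `∑ i, k i = n`, of the multinomial coefficient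
`n! / ∏ i, (k i)!` times `∏ i, N i i ^ (k i * (k i - 1) / 2)` times
`∏_{i < j} N i j ^ (k i * k j)`. -/
theorem sum_prod_pairs_eq_sum_multinomial {T : Type*} [Fintype T] [LinearOrder T]
    (n : ℕ) (N : T → T → ℕ) (hN : ∀ i j, N i j = N j i) :
    (∑ f : Fin n → T,
        ∏ p ∈ univ.filter (fun p : Fin n × Fin n => p.1 < p.2), N (f p.1) (f p.2)) =
      ∑ k ∈ (Fintype.piFinset fun _ : T => range (n + 1)).filter
          (fun k : T → ℕ => ∑ i, k i = n),
        Nat.multinomial univ k *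
          (∏ i : T, N i i ^ (k i * (k i - 1) / 2)) *
          ∏ p ∈ univ.filter (fun p : T × T => p.1 < p.2), N p.1 p.2 ^ (k p.1 * k p.2) := by
  have hmaps : ∀ f ∈ (univ : Finset (Fin n → T)), (fun i => #{c | f c = i}) ∈
      (Fintype.piFinset fun _ : T => range (n + 1)).filter fun k : T → ℕ => ∑ i, k i = n := by
    intro f _
    simp only [mem_filter, Fintype.mem_piFinset, mem_range, Nat.lt_succ_iff]
    refine ⟨fun i => (card_le_univ _).trans_eq (Fintype.card_fin n), ?_⟩
    rw [← card_eq_sum_card_fiberwise fun c _ => mem_coe.2 (mem_univ (f c)), card_univ,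
      Fintype.card_fin]
  rw [← sum_fiberwise_of_maps_to hmaps]
  refine sum_congr rfl fun k hk => ?_
  rw [mul_assoc, ← card_filter_card_fiber_eq_multinomial n k (mem_filter.1 hk).2, ← smul_eq_mul]
  refine sum_eq_card_nsmul fun f hf => ?_
  obtain rfl := (mem_filter.1 hf).2
  simp only [prod_lt_apply_eq_prod_pow_card_fiber N hN n f, Nat.choose_two_right]
end

section
/- Let T be a finite type, n a natural number, N : T → T → ℕ a symmetric function, and f : Fin n → T a function whose fiber over each i ∈ T has cardinality k(i). Then the product, over all unordered pairs {c,d} of distinct elements of Fin n, of N(f c)(f d) equals ∏_{i∈T} N(i,i)^{k(i)(k(i)−1)/2} · ∏_{unordered pairs i≠j in T} N(i,j)^{k(i)·k(j)}. In particular, this product depends on f only through its fiber cardinalities k. -/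
open Finset

theorem card_filter_lt_product_self {α : Type*} [LinearOrder α] (s : Finset α) :
    #{p ∈ s ×ˢ s | p.1 < p.2} = #s * (#s - 1) / 2 := by
  have hswap : #{p ∈ s ×ˢ s | p.2 < p.1} = #{p ∈ s ×ˢ s | p.1 < p.2} :=
    card_nbij' Prod.swap Prod.swap (by intro p; simp; tauto) (by intro p; simp; tauto)
      (by intro p _; simp) (by intro p _; simp)
  have hunion : s.offDiag = {p ∈ s ×ˢ s | p.1 < p.2} ∪ {p ∈ s ×ˢ s | p.2 < p.1} := by
    ext p
    simp only [mem_offDiag, mem_union, mem_filter, mem_product, ne_iff_lt_or_gt]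
    tauto
  have hdisj : Disjoint {p ∈ s ×ˢ s | p.1 < p.2} {p ∈ s ×ˢ s | p.2 < p.1} :=
    disjoint_filter.2 fun p _ h => h.asymm
  have hcard := offDiag_card s
  rw [hunion, card_union_of_disjoint hdisj, hswap] at hcard
  rw [Nat.mul_sub_one]
  omega

theorem card_filter_lt_of_unordered_image_eq {α T : Type*} [Fintype α] [LinearOrder α]
    [LinearOrder T] (f : α → T) {i j : T} (hij : i < j) :
    #{p : α × α | p.1 < p.2 ∧ (min (f p.1) (f p.2), max (f p.1) (f p.2)) = (i, j)} =
      #{c | f c = i} * #{c | f c = j} := by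
  rw [← card_product]
  refine card_nbij' (fun p => if f p.1 = i then p else p.swap)
    (fun p => (min p.1 p.2, max p.1 p.2)) ?_ ?_ ?_ ?_
  all_goals
    rintro ⟨c, d⟩ h
    simp at h ⊢
    grind

/-- For a symmetric weight function `N` on a finite (linearly ordered) type `T` and a
function `f : Fin n → T` whose fiber over each `i : T` has cardinality `k i`, the
product of `N (f c) (f d)` over all unordered pairs of distinct elements `{c, d}` of
`Fin n` equals `∏ i, N i i ^ (k i * (k i - 1) / 2) * ∏_{i < j} N i j ^ (k i * k j)`;
in particular, it depends on `f` only through the fiber cardinalities `k`. -/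
theorem prod_pairs_eq_of_fibers {T : Type*} [Fintype T] [LinearOrder T]
    (n : ℕ) (N : T → T → ℕ) (hN : ∀ i j, N i j = N j i)
    (f : Fin n → T) (k : T → ℕ)
    (hk : ∀ i : T, (univ.filter fun c : Fin n => f c = i).card = k i) :
    (∏ p ∈ univ.filter (fun p : Fin n × Fin n => p.1 < p.2), N (f p.1) (f p.2)) =
      (∏ i : T, N i i ^ (k i * (k i - 1) / 2)) *
        ∏ p ∈ univ.filter (fun p : T × T => p.1 < p.2), N p.1 p.2 ^ (k p.1 * k p.2) := by
  have hfib : ∀ p ∈ univ.filter (fun p : Fin n × Fin n => p.1 < p.2),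
      (min (f p.1) (f p.2), max (f p.1) (f p.2)) ∈ univ.filter (fun q : T × T => q.1 ≤ q.2) := by
    simp
  have hsplit : univ.filter (fun q : T × T => q.1 ≤ q.2) =
      univ.diag ∪ univ.filter (fun q : T × T => q.1 < q.2) := by
    ext q
    simp only [mem_filter, mem_univ, true_and, mem_union, mem_diag, le_iff_eq_or_lt]
  have hdisj : Disjoint (univ : Finset T).diag (univ.filter fun q : T × T => q.1 < q.2) := by
    rw [disjoint_left]
    intro q hq hlt
    exact (mem_filter.1 hlt).2.ne (mem_diag.1 hq).2
  have hconst : ∀ q : T × T,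
      (∏ p ∈ univ.filter (fun p : Fin n × Fin n => p.1 < p.2) with
        (min (f p.1) (f p.2), max (f p.1) (f p.2)) = q, N (f p.1) (f p.2)) =
      N q.1 q.2 ^ #{p : Fin n × Fin n |
        p.1 < p.2 ∧ (min (f p.1) (f p.2), max (f p.1) (f p.2)) = q} := by
    intro q
    rw [filter_filter]
    refine prod_eq_pow_card fun p hp => ?_
    rw [← (mem_filter.1 hp).2.2]
    rcases le_total (f p.1) (f p.2) with h | h
    · simp [h]
    · simp [h, hN (f p.1)]
  rw [← prod_fiberwise_of_maps_to hfib, hsplit, prod_union hdisj, prod_diag]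
  congr 1
  · refine prod_congr rfl fun i _ => ?_
    rw [hconst, ← hk, ← card_filter_lt_product_self]
    congr 2
    ext p
    simp only [mem_filter, mem_univ, true_and, mem_product, Prod.mk.injEq]
    grind
  · refine prod_congr rfl fun q hq => ?_
    rw [hconst, ← hk, ← hk, ← card_filter_lt_of_unordered_image_eq f (mem_filter.1 hq).2]
end
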